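/- Consider the M-FSIG with N users and K = N channels, with fixed squared gains satisfying g_{m,n,k} > 0 for all m, n, k, powers P_n > 0, noise power N_0 > 0, and 1 ≤ M ≤ N. A strategy profile a is a pure Nash equilibrium of the M-FSIG if and only if for every user n: a_n ∈ M_n and I_{n,a_n}(a_{-n}) ≤ I_{n,k}(a_{-n}) for every channel k ∈ M_n. -/

import Mathlib

open scoped Classical
/-- `orderStat Y i` is the i-th smallest value (1-indexed) among `Y 0, …, Y (N-1)`. -/
noncomputable def orderStat {N : ℕ} (Y : Fin N → ℝ) (i : ℕ) : ℝ :=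
  ((List.ofFn Y).mergeSort (· ≤ ·)).getD (i - 1) 0

/-- Interference experienced by user `n` on channel `k` under profile `a`. -/
noncomputable def interf {N : ℕ} (g : Fin N → Fin N → Fin N → ℝ) (P : Fin N → ℝ)
    (n k : Fin N) (a : Fin N → Fin N) : ℝ :=
  ∑ m ∈ Finset.univ.filter (fun m => m ≠ n ∧ a m = k), g m n k * P m

/-- `k` belongs to `M_n`, the set of user `n`'s `M` best channels. -/
def inBestM {N : ℕ} (g : Fin N → Fin N → Fin N → ℝ) (M : ℕ) (n k : Fin N) : Prop :=
  orderStat (fun j => g n n j) (N - M + 1) ≤ g n n k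

/-- Utility of user `n` in the M-FSIG. -/

noncomputable def mUtil {N : ℕ} (g : Fin N → Fin N → Fin N → ℝ) (P : Fin N → ℝ)
    (N0 : ℝ) (M : ℕ) (n : Fin N) (a : Fin N → Fin N) : ℝ :=
  if inBestM g M n (a n) then
    Real.logb 2 (1 + P n * orderStat (fun j => g n n j) (N - M + 1) /
      (N0 + interf g P n (a n) a))
  else 0

/-- Pure Nash equilibrium of the M-FSIG. -/
def isMPNE {N : ℕ} (g : Fin N → Fin N → Fin N → ℝ) (P : Fin N → ℝ) (N0 : ℝ) (M : ℕ)
    (a : Fin N → Fin N) : Prop :=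
  ∀ n b, mUtil g P N0 M n (Function.update a n b) ≤ mUtil g P N0 M n a

lemma exists_eq_orderStat {N : ℕ} (Y : Fin N → ℝ) {i : ℕ} (hi : i - 1 < N) :
    ∃ k, Y k = orderStat Y i := by
  have hlen : i - 1 < ((List.ofFn Y).mergeSort (· ≤ ·)).length := by simpa using hi
  have hmem := List.getElem_mem hlen
  rw [List.mem_mergeSort, List.mem_ofFn] at hmem
  rwa [orderStat, List.getD_eq_getElem _ _ hlen]

lemma interf_update {N : ℕ} (g : Fin N → Fin N → Fin N → ℝ) (P : Fin N → ℝ)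
    (n k b : Fin N) (a : Fin N → Fin N) :
    interf g P n k (Function.update a n b) = interf g P n k a := by
  unfold interf
  congr 1
  ext m
  by_cases hm : m = n <;> simp [hm]

lemma interf_nonneg {N : ℕ} {g : Fin N → Fin N → Fin N → ℝ} {P : Fin N → ℝ}
    (hg : ∀ m n k, 0 < g m n k) (hP : ∀ n, 0 < P n) (n k : Fin N) (a : Fin N → Fin N) :
    0 ≤ interf g P n k a :=
  Finset.sum_nonneg fun m _ => (mul_pos (hg m n k) (hP m)).le

lemma mUtil_update {N : ℕ} (g : Fin N → Fin N → Fin N → ℝ) (P : Fin N → ℝ)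
    (N0 : ℝ) (M : ℕ) (n b : Fin N) (a : Fin N → Fin N) :
    mUtil g P N0 M n (Function.update a n b) =
      if inBestM g M n b then
        Real.logb 2 (1 + P n * orderStat (fun j => g n n j) (N - M + 1) /
          (N0 + interf g P n b a))
      else 0 := by
  simp only [mUtil, Function.update_self, interf_update]

lemma logb_one_add_div_pos {c x : ℝ} (hc : 0 < c) (hx : 0 < x) :
    0 < Real.logb 2 (1 + c / x) :=
  Real.logb_pos one_lt_two (lt_add_of_pos_right 1 (div_pos hc hx))

lemma logb_one_add_div_le_iff {c x y : ℝ} (hc : 0 < c) (hx : 0 < x) (hy : 0 < y) :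
    Real.logb 2 (1 + c / x) ≤ Real.logb 2 (1 + c / y) ↔ y ≤ x := by
  rw [Real.logb_le_logb one_lt_two (by positivity) (by positivity), add_le_add_iff_left,
    div_le_div_iff_of_pos_left hc hx hy]

/-- In the M-FSIG with positive gains, a profile `a` is a pure Nash equilibrium iff every
user `n` uses one of his `M` best channels and experiences there the minimal interference
among his `M` best channels. -/
theorem stmt13 {N : ℕ} (g : Fin N → Fin N → Fin N → ℝ) (P : Fin N → ℝ) (N0 : ℝ) (M : ℕ)
    (hg : ∀ m n k, 0 < g m n k) (hP : ∀ n, 0 < P n) (hN0 : 0 < N0)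
    (hM1 : 1 ≤ M) (hMN : M ≤ N)
    (a : Fin N → Fin N) :
    isMPNE g P N0 M a ↔
      ∀ n, inBestM g M n (a n) ∧
        ∀ k, inBestM g M n k → interf g P n (a n) a ≤ interf g P n k a := by
  refine forall_congr' fun n => ?_
  have hN : N - M + 1 - 1 < N := by omega
  obtain ⟨k₀, hk₀⟩ := exists_eq_orderStat (fun j => g n n j) hN
  have hbest : inBestM g M n k₀ := hk₀.ge
  have hc : 0 < P n * orderStat (fun j => g n n j) (N - M + 1) :=
    mul_pos (hP n) (hk₀ ▸ hg n n k₀)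
  have hden : ∀ k, 0 < N0 + interf g P n k a := fun k =>
    add_pos_of_pos_of_nonneg hN0 (interf_nonneg hg hP n k a)
  simp only [mUtil_update]
  simp only [mUtil]
  constructor
  · intro h
    have ha : inBestM g M n (a n) := by
      by_contra ha
      have h₀ := h k₀
      rw [if_pos hbest, if_neg ha] at h₀
      exact h₀.not_gt (logb_one_add_div_pos hc (hden k₀))
    refine ⟨ha, fun k hk => ?_⟩
    have hk' := h k
    rwa [if_pos hk, if_pos ha, logb_one_add_div_le_iff hc (hden k) (hden (a n)),
      add_le_add_iff_left] at hk'
  · rintro ⟨ha, h⟩ k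
    rw [if_pos ha]
    split_ifs with hk
    · rw [logb_one_add_div_le_iff hc (hden k) (hden (a n)), add_le_add_iff_left]
      exact h k hk
    · exact (logb_one_add_div_pos hc (hden (a n))).le
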